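/- Let (X, dist) be a pseudometric space, α > 0 a real number, and k ≥ 0 a real number. Then for all points w₁, w₂, v in X with dist w₁ w₂ ≤ k, it holds that |1/(dist w₁ v + α) − 1/(dist w₂ v + α)| ≤ k/(α·(k + α)). -/

import Mathlib

theorem sens_aux (α k a b : ℝ) (hα : 0 < α) (hk : 0 ≤ k) (ha : 0 ≤ a) (hb : 0 ≤ b)
    (h : b ≤ a + k) : 1 / (a + α) - 1 / (b + α) ≤ k / (α * (k + α)) := by
  have h1 : 1 / (a + k + α) ≤ 1 / (b + α) :=
    one_div_le_one_div_of_le (by linarith) (by linarith)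
  have h2 : 1 / (a + α) - 1 / (a + k + α) = k / ((a + α) * (a + k + α)) := by
    have : a + α ≠ 0 := by positivity
    have : a + k + α ≠ 0 := by positivity
    field_simp
    ring
  have h3 : k / ((a + α) * (a + k + α)) ≤ k / (α * (k + α)) := by
    apply div_le_div_of_nonneg_left hk (by positivity)
    apply mul_le_mul <;> first | linarith | positivity
  linarith

theorem sensitivity_bound_pseudometric
    {X : Type*} [PseudoMetricSpace X]
    (α : ℝ) (hα : 0 < α) (k : ℝ) (hk : 0 ≤ k)
    (w₁ w₂ v : X) (hadj : dist w₁ w₂ ≤ k) :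
    |1 / (dist w₁ v + α) - 1 / (dist w₂ v + α)| ≤ k / (α * (k + α)) := by
  have t1 := dist_triangle w₁ w₂ v
  have t2 := dist_triangle w₂ w₁ v
  rw [dist_comm w₂ w₁] at t2
  rw [abs_sub_le_iff]
  exact ⟨sens_aux α k _ _ hα hk dist_nonneg dist_nonneg (by linarith),
    sens_aux α k _ _ hα hk dist_nonneg dist_nonneg (by linarith)⟩
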